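/- Let n, n_u, n_y be even positive integers and let A ∈ ℝ^{n×n}, B_u ∈ ℝ^{n×n_u}, C ∈ ℝ^{n_y×n}. The following are equivalent: (i) X = Θ_n satisfies the NSARE, i.e., A^T Θ_n + Θ_n A − Θ_n B_u Θ_{n_u} B_u^T Θ_n + C^T Θ_{n_y} C = 0; (ii) the matrix B_v := Θ_n C^T Θ_{n_y} ∈ ℝ^{n×n_y} satisfies the physical-realizability equation A Θ_n + Θ_n A^T + B_v Θ_{n_y} B_v^T + B_u Θ_{n_u} B_u^T = 0. -/

import Mathlib

open Matrix

/-- The block-diagonal matrix `diag(J, J, ..., J)` built from copies of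
`J = [[0,1],[-1,0]]`, of size `m × m` (for `m` even). -/
def Theta (m : ℕ) : Matrix (Fin m) (Fin m) ℝ :=
  Matrix.of fun i j =>
    if i.val % 2 = 0 ∧ j.val = i.val + 1 then (1 : ℝ)
    else if j.val % 2 = 0 ∧ i.val = j.val + 1 then (-1 : ℝ)
    else 0

theorem Theta_transpose (m : ℕ) : (Theta m)ᵀ = -Theta m := by
  ext i j
  rw [transpose_apply, Matrix.neg_apply]
  simp only [Theta, of_apply]
  split_ifs <;> first | omega | simp

theorem Theta_mul_self {m : ℕ} (hm : Even m) : Theta m * Theta m = -1 := by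
  obtain ⟨r, rfl⟩ := hm
  ext i j
  rw [mul_apply, Matrix.neg_apply, one_apply]
  simp only [Fin.ext_iff]
  obtain ⟨i, hi⟩ := i
  obtain ⟨j, hj⟩ := j
  rcases Nat.mod_two_eq_zero_or_one i with h | h
  · rw [Finset.sum_eq_single (⟨i + 1, by omega⟩ : Fin (r + r))]
    · simp only [Theta, of_apply, and_true]
      split_ifs <;> first | omega | simp
    · rintro ⟨k, hk⟩ - hne
      simp only [ne_eq, Fin.mk.injEq] at hne
      simp only [Theta, of_apply]
      split_ifs <;> first | omega | simp
    · simp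
  · rw [Finset.sum_eq_single (⟨i - 1, by omega⟩ : Fin (r + r))]
    · simp only [Theta, of_apply]
      split_ifs <;> first | omega | simp
    · rintro ⟨k, hk⟩ - hne
      simp only [ne_eq, Fin.mk.injEq] at hne
      simp only [Theta, of_apply]
      split_ifs <;> first | omega | simp
    · simp

theorem Theta_mul_Theta_mul {m : ℕ} (hm : Even m) {k : Type*} (M : Matrix (Fin m) k ℝ) :
    Theta m * (Theta m * M) = -M := by
  rw [← Matrix.mul_assoc, Theta_mul_self hm, Matrix.neg_mul, Matrix.one_mul]

theorem Theta_mul_mul_Theta_eq_zero_iff {m : ℕ} (hm : Even m) (M : Matrix (Fin m) (Fin m) ℝ) :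
    Theta m * M * Theta m = 0 ↔ M = 0 := by
  refine ⟨fun h => ?_, fun h => by simp [h]⟩
  have h' : Theta m * (Theta m * M * Theta m) * Theta m = M := by
    simp [Matrix.mul_assoc, Theta_mul_Theta_mul hm, Theta_mul_self hm]
  rw [← h', h, Matrix.mul_zero, Matrix.zero_mul]

theorem stmt_15 (n nu ny : ℕ) (hn : Even n) (hn0 : 0 < n)
    (hnu : Even nu) (hnu0 : 0 < nu) (hny : Even ny) (hny0 : 0 < ny)
    (A : Matrix (Fin n) (Fin n) ℝ) (Bu : Matrix (Fin n) (Fin nu) ℝ)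
    (C : Matrix (Fin ny) (Fin n) ℝ)
    (Bv : Matrix (Fin n) (Fin ny) ℝ) (hBv : Bv = Theta n * Cᵀ * Theta ny) :
    (Aᵀ * Theta n + Theta n * A - Theta n * Bu * Theta nu * Buᵀ * Theta n +
        Cᵀ * Theta ny * C = 0) ↔
      (A * Theta n + Theta n * Aᵀ + Bv * Theta ny * Bvᵀ + Bu * Theta nu * Buᵀ = 0) := by
  rw [← Theta_mul_mul_Theta_eq_zero_iff hn, ← neg_eq_zero]
  have key : -(Theta n * (Aᵀ * Theta n + Theta n * A -
      Theta n * Bu * Theta nu * Buᵀ * Theta n + Cᵀ * Theta ny * C) * Theta n) =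
      A * Theta n + Theta n * Aᵀ + Bv * Theta ny * Bvᵀ + Bu * Theta nu * Buᵀ := by
    subst hBv
    simp only [transpose_mul, transpose_transpose, Theta_transpose, Matrix.mul_add,
      Matrix.mul_sub, Matrix.add_mul, Matrix.sub_mul, Matrix.mul_assoc, Matrix.neg_mul,
      Matrix.mul_neg, Theta_mul_Theta_mul hn, Theta_mul_Theta_mul hny, Theta_mul_self hn,
      Matrix.mul_one, neg_neg]
    abel
  rw [key]
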